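/- Let N ≥ 3 be an integer. Suppose x_1,…,x_N, y_1,…,y_N are real numbers satisfying the constraints: x_j ≥ 0 for all j; y_1 = 1 and 0 ≤ y_j ≤ 1 for 2 ≤ j ≤ N; ∑_{j=1}^N x_j = ∑_{j=1}^N y_j; and ∏_{j=1}^N x_j = ∏_{j=1}^N y_j. Then x_1 ≤ N−1, and x_1 = N−1 if and only if x_2 = ⋯ = x_N = 0 and exactly one of the y_j equals 0 while all the others equal 1. -/

import Mathlib

/-- Weierstrass' product inequality for factors in the unit interval. -/
theorem one_sub_sum_one_sub_le_prod {ι : Type*} (s : Finset ι) (y : ι → ℝ)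
    (hy : ∀ j, 0 ≤ y j ∧ y j ≤ 1) : 1 - ∑ j ∈ s, (1 - y j) ≤ ∏ j ∈ s, y j := by
  classical
  induction s using Finset.induction_on with
  | empty => simp
  | insert a s ha ih =>
    rw [Finset.sum_insert ha, Finset.prod_insert ha]
    have hle : ∏ j ∈ s, y j ≤ 1 := Finset.prod_le_one (fun j _ => (hy j).1) fun j _ => (hy j).2
    nlinarith [mul_nonneg (sub_nonneg.2 (hy a).2) (sub_nonneg.2 hle)]

/-- The unweighted AM-GM inequality without roots. -/
theorem prod_le_sum_div_pow {n : ℕ} (hn : n ≠ 0) (z : Fin n → ℝ) (hz : ∀ j, 0 ≤ z j) :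
    ∏ j, z j ≤ ((∑ j, z j) / n) ^ n := by
  have hn' : (0 : ℝ) < n := by exact_mod_cast Nat.pos_of_ne_zero hn
  have h := Real.geom_mean_le_arith_mean Finset.univ (fun _ => 1) z (fun _ _ => zero_le_one)
    (by simpa using hn') fun j _ => hz j
  simp only [Real.rpow_one, Finset.sum_const, Finset.card_univ, Fintype.card_fin, nsmul_eq_mul,
    mul_one, one_mul] at h
  have hp : 0 ≤ ∏ j, z j := Finset.prod_nonneg fun j _ => hz j
  calc ∏ j, z j = ((∏ j, z j) ^ ((n : ℝ)⁻¹)) ^ n := (Real.rpow_inv_natCast_pow hp hn).symm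
    _ ≤ _ := pow_le_pow_left₀ (Real.rpow_nonneg hp _) h n

/-- If the first coordinate of `(a, z)` is at least `n`, the sum and product constraints force
`a = n`, `z = 0` and `∑ j, (1 - y j) = 1`. -/
theorem extremal_of_le {n : ℕ} (hn : 2 ≤ n) (a : ℝ) (z y : Fin n → ℝ) (hz : ∀ j, 0 ≤ z j)
    (hy : ∀ j, 0 ≤ y j ∧ y j ≤ 1) (hsum : a + ∑ j, z j = 1 + ∑ j, y j)
    (hprod : a * ∏ j, z j = ∏ j, y j) (ha : (n : ℝ) ≤ a) :
    a = n ∧ (∀ j, z j = 0) ∧ ∑ j, (1 - y j) = 1 := by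
  have hn2 : (2 : ℝ) ≤ n := by exact_mod_cast hn
  have hW := one_sub_sum_one_sub_le_prod Finset.univ y hy
  have hA := prod_le_sum_div_pow (by omega) z hz
  have hD : ∑ j, (1 - y j) = n - ∑ j, y j := by simp
  have hD0 : 0 ≤ ∑ j, (1 - y j) := Finset.sum_nonneg fun j _ => sub_nonneg.2 (hy j).2
  have hT0 : 0 ≤ ∑ j, z j := Finset.sum_nonneg fun j _ => hz j
  have hz0 : ∑ j, z j = 0 → ∀ j, z j = 0 := fun h j =>
    (Finset.sum_eq_zero_iff_of_nonneg fun j _ => hz j).1 h j (Finset.mem_univ j)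
  set T := ∑ j, z j
  set q := T / n with hq
  have hTq : T = n * q := by rw [hq]; field_simp
  have hq0 : 0 ≤ q := by positivity
  have hT1 : T ≤ 1 := by linarith
  have hq2 : q ≤ 1 / 2 := by nlinarith
  have hpow : q ^ n ≤ q ^ 2 := pow_le_pow_of_le_one hq0 (by linarith) hn
  have hP : a * ∏ j, z j ≤ a * q ^ 2 :=
    mul_le_mul_of_nonneg_left (hA.trans hpow) (by linarith)
  have hsq : a * q ^ 2 ≤ T / 2 + (a - n) / 4 := by
    have h1 : n * q ^ 2 ≤ T / 2 := by nlinarith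
    have h2 : q ^ 2 ≤ 1 / 4 := by nlinarith
    nlinarith
  have haT : a = n ∧ T = 0 := by constructor <;> linarith
  exact ⟨haT.1, hz0 haT.2, by linarith [haT.1, haT.2]⟩

theorem three_mean_optimization (N : ℕ) (hN : 3 ≤ N) (x y : Fin N → ℝ)
    (hx : ∀ j, 0 ≤ x j)
    (hy1 : y ⟨0, by omega⟩ = 1)
    (hy : ∀ j, 0 ≤ y j ∧ y j ≤ 1)
    (hsum : ∑ j, x j = ∑ j, y j)
    (hprod : ∏ j, x j = ∏ j, y j) :
    x ⟨0, by omega⟩ ≤ (N : ℝ) - 1 ∧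
      (x ⟨0, by omega⟩ = (N : ℝ) - 1 ↔
        (∀ j, j ≠ ⟨0, by omega⟩ → x j = 0) ∧
        (∃ k : Fin N, y k = 0 ∧ ∀ j, j ≠ k → y j = 1)) := by
  obtain ⟨n, rfl⟩ : ∃ n, N = n + 1 := ⟨N - 1, by omega⟩
  change y 0 = 1 at hy1
  change x 0 ≤ _ ∧ (x 0 = _ ↔ (∀ j, j ≠ 0 → x j = 0) ∧ _)
  have hcast : ((n + 1 : ℕ) : ℝ) - 1 = n := by push_cast; ring
  rw [hcast]
  have key : (n : ℝ) ≤ x 0 → _ := extremal_of_le (by omega) (x 0) (fun j => x j.succ)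
    (fun j => y j.succ) (fun j => hx _) (fun j => hy _)
    (by rw [Fin.sum_univ_succ, Fin.sum_univ_succ, hy1] at hsum; exact hsum)
    (by rw [Fin.prod_univ_succ, Fin.prod_univ_succ, hy1, one_mul] at hprod; exact hprod)
  refine ⟨?_, fun h => ?_, ?_⟩
  · by_contra! h
    exact h.ne' (key h.le).1
  · obtain ⟨-, hz, hD⟩ := key h.ge
    have hx0 : ∀ j, j ≠ 0 → x j = 0 := fun j hj => by
      obtain ⟨i, rfl⟩ := Fin.exists_succ_eq.2 hj
      exact hz i
    have hlast : Fin.last n ≠ 0 := by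
      rw [Ne, Fin.ext_iff]
      simp only [Fin.val_last, Fin.val_zero]
      omega
    have hP : ∏ j, y j = 0 :=
      hprod ▸ Finset.prod_eq_zero (Finset.mem_univ (Fin.last n)) (hx0 _ hlast)
    obtain ⟨k, -, hk⟩ := Finset.prod_eq_zero_iff.1 hP
    refine ⟨hx0, k, hk, fun j hj => ?_⟩
    have hD' : ∑ j, (1 - y j) = 1 := by rw [Fin.sum_univ_succ, hy1, hD]; ring
    rw [← Finset.add_sum_erase _ _ (Finset.mem_univ k), hk] at hD'
    have hz : ∑ j ∈ Finset.univ.erase k, (1 - y j) = 0 := by linarith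
    have := (Finset.sum_eq_zero_iff_of_nonneg fun j _ => sub_nonneg.2 (hy j).2).1 hz j
      (Finset.mem_erase.2 ⟨hj, Finset.mem_univ j⟩)
    linarith
  · rintro ⟨hx0, k, hk, hk1⟩
    have hX : ∑ j, x j = x 0 := Fintype.sum_eq_single 0 hx0
    have hY : ∑ j, (1 - y j) = 1 := by
      rw [Fintype.sum_eq_single k fun j hj => by rw [hk1 j hj, sub_self], hk, sub_zero]
    rw [Finset.sum_sub_distrib] at hY
    simp only [Finset.sum_const, Finset.card_univ, Fintype.card_fin, nsmul_eq_mul, mul_one] at hY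
    linarith
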